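/- arXiv:2205.05148 — 4 statements merged into one kernel-verified Lean document; each statement's English description precedes it below -/
import Mathlib

section
/- Let Q be a relatively congruence-distributive quasivariety. Then Q has the Q-congruence extension property if and only if Q_RFSI has the Q-congruence extension property. -/
open FirstOrder Language Set

universe u

namespace Transfer

variable (L : FirstOrder.Language.{u, u})

/-- A bundled `L`-structure with carrier in universe `u`. -/
structure Struc : Type (u + 1) where
  Carrier : Type u
  [str : L.Structure Carrier]

attribute [instance] Struc.str

/-- Product structure on a Pi type. -/
instance piStructure {ι : Type u} (M : ι → Type u) [∀ i, L.Structure (M i)] :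
    L.Structure (∀ i, M i) where
  funMap f x i := Structure.funMap f fun j => x j i
  RelMap r x := ∀ i, Structure.RelMap r fun j => x j i

/-- Product structure on a binary product. -/
instance prodStructure (M N : Type u) [L.Structure M] [L.Structure N] :
    L.Structure (M × N) where
  funMap f x := (Structure.funMap f fun j => (x j).1, Structure.funMap f fun j => (x j).2)
  RelMap r x := Structure.RelMap r (fun j => (x j).1) ∧ Structure.RelMap r (fun j => (x j).2)

variable {L}

/-- The bundled structure on a substructure. -/
abbrev ofSub (B : Struc L) (S : L.Substructure B.Carrier) : Struc L := ⟨S⟩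

/-- The kernel of a map, as a set of pairs. -/
def kerSet {α β : Type u} (f : α → β) : Set (α × α) := {p | f p.1 = f p.2}

/-- The restriction of a binary relation on `B` to a substructure `S`. -/
def restrict {B : Struc L} (S : L.Substructure B.Carrier)
    (Θ : Set (B.Carrier × B.Carrier)) : Set ((ofSub B S).Carrier × (ofSub B S).Carrier) :=
  {p | ((p.1 : B.Carrier), (p.2 : B.Carrier)) ∈ Θ}

/-- The image of a binary relation on a substructure `S` in `B`. -/
def lift {B : Struc L} (S : L.Substructure B.Carrier)
    (Θ : Set ((ofSub B S).Carrier × (ofSub B S).Carrier)) : Set (B.Carrier × B.Carrier) :=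
  (fun p => ((p.1 : B.Carrier), (p.2 : B.Carrier))) '' Θ

/-- The set of `Q`-congruences of `A`: kernels of homomorphisms into members of `Q`. -/
def ConQ (Q : Set (Struc L)) (A : Struc L) : Set (Set (A.Carrier × A.Carrier)) :=
  {θ | ∃ M ∈ Q, ∃ f : A.Carrier →[L] M.Carrier, θ = kerSet f}

/-- The least `Q`-congruence of `A` containing `R`. -/
def cgQ (Q : Set (Struc L)) (A : Struc L) (R : Set (A.Carrier × A.Carrier)) :
    Set (A.Carrier × A.Carrier) :=
  ⋂₀ {θ | θ ∈ ConQ Q A ∧ R ⊆ θ}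

/-- The join of two `Q`-congruences in `Con_Q A`. -/
def joinQ (Q : Set (Struc L)) (A : Struc L) (θ φ : Set (A.Carrier × A.Carrier)) :
    Set (A.Carrier × A.Carrier) :=
  cgQ Q A (θ ∪ φ)

/-- `θ` is a meet-irreducible element of `Con_Q A`. -/
def MeetIrred (Q : Set (Struc L)) (A : Struc L) (θ : Set (A.Carrier × A.Carrier)) : Prop :=
  θ ∈ ConQ Q A ∧
    ∀ θ₁ ∈ ConQ Q A, ∀ θ₂ ∈ ConQ Q A, θ = θ₁ ∩ θ₂ → θ = θ₁ ∨ θ = θ₂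

/-- `θ` is a completely meet-irreducible element of `Con_Q A`. -/
def CompletelyMeetIrred (Q : Set (Struc L)) (A : Struc L)
    (θ : Set (A.Carrier × A.Carrier)) : Prop :=
  θ ∈ ConQ Q A ∧
    ∀ S ⊆ ConQ Q A, θ = ⋂₀ S → θ ∈ S

/-- The class of relatively finitely subdirectly irreducible members of `Q`. -/
def RFSI (Q : Set (Struc L)) : Set (Struc L) :=
  {A | A ∈ Q ∧ MeetIrred Q A (Set.diagonal A.Carrier)}

/-- The class of relatively subdirectly irreducible members of `Q`. -/
def RSI (Q : Set (Struc L)) : Set (Struc L) :=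
  {A | A ∈ Q ∧ CompletelyMeetIrred Q A (Set.diagonal A.Carrier)}

/-- `B` has the `Q`-congruence extension property. -/
def HasQCEP (Q : Set (Struc L)) (B : Struc L) : Prop :=
  ∀ S : L.Substructure B.Carrier, ∀ θ ∈ ConQ Q (ofSub B S),
    ∃ Φ ∈ ConQ Q B, restrict S Φ = θ

/-- A class `K` of members of `Q` has the `Q`-congruence extension property. -/
def ClassQCEP (Q K : Set (Struc L)) : Prop :=
  ∀ B ∈ K, HasQCEP Q B

variable (L)

/-- `Q` is a quasivariety: closed under isomorphisms, substructures, direct products,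
and ultraproducts. -/
def IsQuasivariety (Q : Set (Struc L)) : Prop :=
  (∀ A ∈ Q, ∀ B : Struc L, Nonempty (A.Carrier ≃[L] B.Carrier) → B ∈ Q) ∧
  (∀ B ∈ Q, ∀ S : L.Substructure B.Carrier, ofSub B S ∈ Q) ∧
  (∀ (ι : Type u) (f : ι → Struc L), (∀ i, f i ∈ Q) →
    (⟨∀ i, (f i).Carrier⟩ : Struc L) ∈ Q) ∧
  (∀ (ι : Type u) (f : ι → Struc L) (U : Ultrafilter ι), (∀ i, f i ∈ Q) →
    (⟨(U : Filter ι).Product fun i => (f i).Carrier⟩ : Struc L) ∈ Q)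

/-- `V` is a variety: closed under homomorphic images, substructures, and direct products. -/
def IsVariety (V : Set (Struc L)) : Prop :=
  (∀ A ∈ V, ∀ B : Struc L, ∀ f : A.Carrier →[L] B.Carrier, Function.Surjective f → B ∈ V) ∧
  (∀ B ∈ V, ∀ S : L.Substructure B.Carrier, ofSub B S ∈ V) ∧
  (∀ (ι : Type u) (f : ι → Struc L), (∀ i, f i ∈ V) →
    (⟨∀ i, (f i).Carrier⟩ : Struc L) ∈ V)

variable {L}

/-- `Q` is relatively congruence-distributive: `Con_Q A` is a distributive lattice
for every `A ∈ Q`. -/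
def RelCongDist (Q : Set (Struc L)) : Prop :=
  ∀ A ∈ Q, ∀ θ ∈ ConQ Q A, ∀ φ ∈ ConQ Q A, ∀ ψ ∈ ConQ Q A,
    θ ∩ joinQ Q A φ ψ = joinQ Q A (θ ∩ φ) (θ ∩ ψ)

/-- Relation composition `Θ ∘ Φ = {(a,c) : ∃ b, (a,b) ∈ Φ ∧ (b,c) ∈ Θ}`. -/
def relComp {α : Type u} (Θ Φ : Set (α × α)) : Set (α × α) :=
  {p | ∃ b, (p.1, b) ∈ Φ ∧ (b, p.2) ∈ Θ}

/-- `Q` is relatively congruence-permutable. -/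
def RelCongPerm (Q : Set (Struc L)) : Prop :=
  ∀ A ∈ Q, ∀ θ ∈ ConQ Q A, ∀ φ ∈ ConQ Q A, relComp θ φ = relComp φ θ

/-- A class `K` is closed under substructures. -/
def SubClosed (K : Set (Struc L)) : Prop :=
  ∀ B ∈ K, ∀ S : L.Substructure B.Carrier, ofSub B S ∈ K

/-- A class `K` is closed under isomorphisms. -/
def IsoClosed (K : Set (Struc L)) : Prop :=
  ∀ A ∈ K, ∀ B : Struc L, Nonempty (A.Carrier ≃[L] B.Carrier) → B ∈ K

/-- A universal class: closed under isomorphisms, substructures, and ultraproducts. -/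
def IsUniversalClass (K : Set (Struc L)) : Prop :=
  IsoClosed K ∧ SubClosed K ∧
  (∀ (ι : Type u) (f : ι → Struc L) (U : Ultrafilter ι), (∀ i, f i ∈ K) →
    (⟨(U : Filter ι).Product fun i => (f i).Carrier⟩ : Struc L) ∈ K)

/-- The extension property for a class `K`. -/
def HasEP (K : Set (Struc L)) : Prop :=
  ∀ A ∈ K, ∀ B ∈ K, ∀ C ∈ K,
    ∀ (φB : A.Carrier →[L] B.Carrier) (φC : A.Carrier →[L] C.Carrier),
      Function.Injective φB → Function.Surjective φC →
      ∃ D ∈ K, ∃ (ψB : B.Carrier →[L] D.Carrier) (ψC : C.Carrier →[L] D.Carrier),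
        Function.Injective ψC ∧ ∀ a, ψB (φB a) = ψC (φC a)

/-- The one-sided amalgamation property for a class `K`. -/
def Has1AP (K : Set (Struc L)) : Prop :=
  ∀ A ∈ K, ∀ B ∈ K, ∀ C ∈ K,
    ∀ (φB : A.Carrier →[L] B.Carrier) (φC : A.Carrier →[L] C.Carrier),
      Function.Injective φB → Function.Injective φC →
      ∃ D ∈ K, ∃ (ψB : B.Carrier →[L] D.Carrier) (ψC : C.Carrier →[L] D.Carrier),
        Function.Injective ψC ∧ ∀ a, ψB (φB a) = ψC (φC a)

/-- Every doubly injective span in `K` has an amalgam in `K'`. -/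
def HasAmalgamIn (K K' : Set (Struc L)) : Prop :=
  ∀ A ∈ K, ∀ B ∈ K, ∀ C ∈ K,
    ∀ (φB : A.Carrier →[L] B.Carrier) (φC : A.Carrier →[L] C.Carrier),
      Function.Injective φB → Function.Injective φC →
      ∃ D ∈ K', ∃ (ψB : B.Carrier →[L] D.Carrier) (ψC : C.Carrier →[L] D.Carrier),
        Function.Injective ψB ∧ Function.Injective ψC ∧ ∀ a, ψB (φB a) = ψC (φC a)

/-- The amalgamation property for a class `K`. -/
def HasAP (K : Set (Struc L)) : Prop := HasAmalgamIn K K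

/-- The transferable injections property for a class `K`. -/
def HasTIP (K : Set (Struc L)) : Prop :=
  ∀ A ∈ K, ∀ B ∈ K, ∀ C ∈ K,
    ∀ (φB : A.Carrier →[L] B.Carrier) (φC : A.Carrier →[L] C.Carrier),
      Function.Injective φB →
      ∃ D ∈ K, ∃ (ψB : B.Carrier →[L] D.Carrier) (ψC : C.Carrier →[L] D.Carrier),
        Function.Injective ψC ∧ ∀ a, ψB (φB a) = ψC (φC a)

/-- Every doubly injective span in `K` has a strong amalgam in `K'`. -/
def HasStrongAmalgamIn (K K' : Set (Struc L)) : Prop :=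
  ∀ A ∈ K, ∀ B ∈ K, ∀ C ∈ K,
    ∀ (φB : A.Carrier →[L] B.Carrier) (φC : A.Carrier →[L] C.Carrier),
      Function.Injective φB → Function.Injective φC →
      ∃ D ∈ K', ∃ (ψB : B.Carrier →[L] D.Carrier) (ψC : C.Carrier →[L] D.Carrier),
        Function.Injective ψB ∧ Function.Injective ψC ∧ (∀ a, ψB (φB a) = ψC (φC a)) ∧
        Set.range (fun a => ψB (φB a)) = Set.range ψB ∩ Set.range ψC

/-- The strong amalgamation property for a class `K`. -/
def HasSAP (K : Set (Struc L)) : Prop := HasStrongAmalgamIn K K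

/-- `φ : A → B` is an epimorphism in the class `K`. -/
def IsEpiIn (K : Set (Struc L)) {A B : Struc L} (φ : A.Carrier →[L] B.Carrier) : Prop :=
  ∀ C ∈ K, ∀ ψ₁ ψ₂ : B.Carrier →[L] C.Carrier,
    ψ₁.comp φ = ψ₂.comp φ → ψ₁ = ψ₂

/-- The class `K` has surjective epimorphisms. -/
def HasSE (K : Set (Struc L)) : Prop :=
  ∀ A ∈ K, ∀ B ∈ K, ∀ φ : A.Carrier →[L] B.Carrier,
    IsEpiIn K φ → Function.Surjective φ

/-- A substructure `S` of `B` is a retract of `B`. -/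
def IsRetract (B : Struc L) (S : L.Substructure B.Carrier) : Prop :=
  ∃ ψ : B.Carrier →[L] (ofSub B S).Carrier, ∀ a : (ofSub B S).Carrier, ψ (a : B.Carrier) = a


/-- The smallest variety containing `V₁ ∪ V₂`. -/
def varJoin (L : FirstOrder.Language.{u, u}) (V₁ V₂ : Set (Struc L)) : Set (Struc L) :=
  ⋂₀ {W | IsVariety L W ∧ V₁ ⊆ W ∧ V₂ ⊆ W}

section QuasivarietyCongruences

variable {L : FirstOrder.Language.{u, u}} {Q : Set (Struc L)} {A B C : Struc L}

/-- The inverse image of a binary relation under a map. -/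
def pullback {α β : Type u} (f : α → β) (θ : Set (β × β)) : Set (α × α) :=
  {p | (f p.1, f p.2) ∈ θ}

theorem pullback_mem_ConQ (f : A.Carrier →[L] C.Carrier) {θ : Set (C.Carrier × C.Carrier)}
    (hθ : θ ∈ ConQ Q C) : pullback f θ ∈ ConQ Q A := by
  obtain ⟨M, hM, g, rfl⟩ := hθ
  exact ⟨M, hM, g.comp f, rfl⟩

theorem restrict_mem_ConQ (S : L.Substructure B.Carrier) {θ : Set (B.Carrier × B.Carrier)}
    (hθ : θ ∈ ConQ Q B) : restrict S θ ∈ ConQ Q (ofSub B S) :=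
  pullback_mem_ConQ (A := ofSub B S) S.subtype.toHom hθ

theorem diagonal_mem_ConQ (hA : A ∈ Q) : Set.diagonal A.Carrier ∈ ConQ Q A :=
  ⟨A, hA, Hom.id L A.Carrier, rfl⟩

theorem subset_cgQ (R : Set (A.Carrier × A.Carrier)) : R ⊆ cgQ Q A R :=
  subset_sInter fun _ h => h.2

theorem cgQ_subset {R θ : Set (A.Carrier × A.Carrier)} (hθ : θ ∈ ConQ Q A) (h : R ⊆ θ) :
    cgQ Q A R ⊆ θ :=
  sInter_subset_of_mem ⟨hθ, h⟩

/-- The image of `A` under a homomorphism with meet-irreducible kernel is relatively finitely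
subdirectly irreducible. -/
theorem mem_RFSI_of_surjective (hC : C ∈ Q) (f : A.Carrier →[L] C.Carrier)
    (hf : Function.Surjective f) (h : MeetIrred Q A (kerSet f)) : C ∈ RFSI Q := by
  refine ⟨hC, diagonal_mem_ConQ hC, fun θ₁ h₁ θ₂ h₂ he => ?_⟩
  have hpull : ∀ θ, kerSet f = pullback f θ → Set.diagonal C.Carrier = θ := by
    intro θ hθ
    ext ⟨x, y⟩
    obtain ⟨a, rfl⟩ := hf x
    obtain ⟨b, rfl⟩ := hf y
    exact Set.ext_iff.1 hθ (a, b)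
  refine (h.2 _ (pullback_mem_ConQ f h₁) _ (pullback_mem_ConQ f h₂) ?_).imp
    (hpull θ₁) (hpull θ₂)
  ext p
  exact Set.ext_iff.1 he (f p.1, f p.2)

variable [L.IsAlgebraic]

/-- A map preserving all operations is a homomorphism, in a language without relations. -/
def homOfMapFun {M N : Type u} [L.Structure M] [L.Structure N] (f : M → N)
    (hf : ∀ {n} (F : L.Functions n) (x : Fin n → M),
      f (Structure.funMap F x) = Structure.funMap F (f ∘ x)) : M →[L] N where
  toFun := f
  map_fun' := hf
  map_rel' r := isEmptyElim r

theorem sInter_mem_ConQ (hQ : IsQuasivariety L Q) {S : Set (Set (A.Carrier × A.Carrier))}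
    (hS : S ⊆ ConQ Q A) : ⋂₀ S ∈ ConQ Q A := by
  choose M hM f hf using fun θ : S => hS θ.2
  refine ⟨_, hQ.2.2.1 S M hM, homOfMapFun (fun a θ => f θ a) ?_, ?_⟩
  · intro n F x
    funext θ
    exact (f θ).map_fun F x
  · ext p
    rw [mem_sInter]
    constructor
    · intro h
      funext θ
      have := h θ θ.2
      rwa [hf θ] at this
    · intro h θ hθ
      have := congrFun h ⟨θ, hθ⟩
      rw [show θ = _ from hf ⟨θ, hθ⟩]
      exact this

/-- Unions of nonempty chains of `Q`-congruences are `Q`-congruences, by closure under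
ultraproducts. -/
theorem sUnion_mem_ConQ (hQ : IsQuasivariety L Q) {c : Set (Set (A.Carrier × A.Carrier))}
    (hc : c ⊆ ConQ Q A) (hchain : IsChain (· ⊆ ·) c) (hne : c.Nonempty) :
    ⋃₀ c ∈ ConQ Q A := by
  choose M hM f hf using fun θ : c => hc θ.2
  have : Nonempty c := hne.to_subtype
  have : IsDirectedOrder c := ⟨fun a b => by
    rcases hchain.total a.2 b.2 with h | h
    · exact ⟨b, h, le_rfl⟩
    · exact ⟨a, le_rfl, h⟩⟩
  let U : Ultrafilter c := Ultrafilter.of Filter.atTop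
  have hU : (U : Filter c) ≤ Filter.atTop := Ultrafilter.of_le _
  refine ⟨_, hQ.2.2.2 c M U hM, homOfMapFun
    (fun a => Quotient.mk'' (s₁ := (U : Filter c).productSetoid _) fun θ => f θ a) ?_, ?_⟩
  · intro n F x
    refine Eq.trans ?_ (Ultraproduct.funMap_cast (u := U) F (fun i θ => f θ (x i))).symm
    congr 1
    funext θ
    exact (f θ).map_fun F x
  · ext p
    have key : p ∈ kerSet (fun a =>
        (Quotient.mk'' (s₁ := (U : Filter c).productSetoid _) fun θ => f θ a :
          (U : Filter c).Product fun θ => (M θ).Carrier)) ↔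
        ∀ᶠ θ : c in U, p ∈ θ.1 := by
      refine Quotient.eq''.trans (Filter.eventually_congr (Filter.Eventually.of_forall ?_))
      intro θ
      rw [hf θ]
      rfl
    refine Iff.trans ?_ key.symm
    constructor
    · rintro ⟨θ, hθ, hp⟩
      exact ((Filter.eventually_ge_atTop (⟨θ, hθ⟩ : c)).filter_mono hU).mono
        fun φ hφ => hφ hp
    · intro h
      obtain ⟨θ, hθ⟩ := h.exists
      exact ⟨θ, θ.2, hθ⟩

/-- A set of `Q`-congruences that is inaccessible by unions of chains has maximal elements above
each of its members. -/
theorem exists_maximal_ConQ (hQ : IsQuasivariety L Q)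
    (P : Set (A.Carrier × A.Carrier) → Prop)
    (hP : ∀ c : Set (Set (A.Carrier × A.Carrier)), (∀ θ ∈ c, P θ) → P (⋃₀ c))
    {θ : Set (A.Carrier × A.Carrier)} (hθ : θ ∈ ConQ Q A) (hPθ : P θ) :
    ∃ φ ∈ ConQ Q A, P φ ∧ θ ⊆ φ ∧ ∀ ψ ∈ ConQ Q A, P ψ → φ ⊆ ψ → ψ = φ := by
  obtain ⟨φ, hθφ, hmax⟩ := zorn_subset_nonempty {φ | φ ∈ ConQ Q A ∧ P φ}
    (fun c hc hchain hne => ⟨⋃₀ c, ⟨sUnion_mem_ConQ hQ (fun s hs => (hc hs).1) hchain hne,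
      hP c fun s hs => (hc hs).2⟩, fun s hs => subset_sUnion_of_mem hs⟩) θ ⟨hθ, hPθ⟩
  exact ⟨φ, hmax.prop.1, hmax.prop.2, hθφ, fun ψ hψ hPψ h => (hmax.eq_of_subset ⟨hψ, hPψ⟩ h).symm⟩

theorem exists_meetIrred_notMem (hQ : IsQuasivariety L Q) {θ : Set (A.Carrier × A.Carrier)}
    (hθ : θ ∈ ConQ Q A) {p : A.Carrier × A.Carrier} (hp : p ∉ θ) :
    ∃ φ, MeetIrred Q A φ ∧ θ ⊆ φ ∧ p ∉ φ := by
  obtain ⟨φ, hφ, hpφ, hle, hmax⟩ := exists_maximal_ConQ hQ (fun φ => p ∉ φ)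
    (fun c hc ⟨s, hs, hps⟩ => hc s hs hps) hθ hp
  refine ⟨φ, ⟨hφ, fun θ₁ h₁ θ₂ h₂ h => ?_⟩, hle, hpφ⟩
  by_cases hp₁ : p ∈ θ₁
  · have hp₂ : p ∉ θ₂ := fun hp₂ => hpφ (h ▸ ⟨hp₁, hp₂⟩)
    exact Or.inr (hmax θ₂ h₂ hp₂ (h.trans_subset inter_subset_right)).symm
  · exact Or.inl (hmax θ₁ h₁ hp₁ (h.trans_subset inter_subset_left)).symm

theorem cgQ_mem_ConQ (hQ : IsQuasivariety L Q) (R : Set (A.Carrier × A.Carrier)) :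
    cgQ Q A R ∈ ConQ Q A :=
  sInter_mem_ConQ hQ fun _ h => h.1

/-- Under relative congruence-distributivity, meet-irreducible `Q`-congruences are meet-prime. -/
theorem MeetIrred.subset_or_subset (hQ : IsQuasivariety L Q) (hd : RelCongDist Q) (hA : A ∈ Q)
    {θ θ₁ θ₂ : Set (A.Carrier × A.Carrier)} (hθ : MeetIrred Q A θ)
    (h₁ : θ₁ ∈ ConQ Q A) (h₂ : θ₂ ∈ ConQ Q A) (h : θ₁ ∩ θ₂ ⊆ θ) : θ₁ ⊆ θ ∨ θ₂ ⊆ θ := by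
  have hj₁ : joinQ Q A θ θ₁ ∈ ConQ Q A := cgQ_mem_ConQ hQ _
  have hj₂ : joinQ Q A θ θ₂ ∈ ConQ Q A := cgQ_mem_ConQ hQ _
  have hle : joinQ Q A θ θ₁ ∩ joinQ Q A θ θ₂ ⊆ θ := by
    rw [hd A hA _ hj₁ θ hθ.1 θ₂ h₂]
    refine cgQ_subset hθ.1 (union_subset inter_subset_right ?_)
    rw [inter_comm, hd A hA θ₂ h₂ θ hθ.1 θ₁ h₁]
    exact cgQ_subset hθ.1 (union_subset inter_subset_right (by rwa [inter_comm]))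
  have hge : ∀ φ, θ ⊆ joinQ Q A θ φ := fun φ => subset_union_left.trans (subset_cgQ _)
  have hsub : ∀ φ, φ ⊆ joinQ Q A θ φ := fun φ => subset_union_right.trans (subset_cgQ _)
  rcases hθ.2 _ hj₁ _ hj₂ (subset_antisymm (subset_inter (hge _) (hge _)) hle) with e | e
  · exact Or.inl ((hsub θ₁).trans e.symm.subset)
  · exact Or.inr ((hsub θ₂).trans e.symm.subset)

/-- A `Q`-congruence containing the kernel of a surjective homomorphism `f` is the inverse image
of a `Q`-congruence under `f`. -/
theorem exists_pullback_eq (f : A.Carrier →[L] C.Carrier) (hf : Function.Surjective f)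
    {θ : Set (A.Carrier × A.Carrier)} (hθ : θ ∈ ConQ Q A) (h : kerSet f ⊆ θ) :
    ∃ φ ∈ ConQ Q C, pullback f φ = θ := by
  obtain ⟨M, hM, g, rfl⟩ := hθ
  have hg : ∀ a, g (Function.surjInv hf (f a)) = g a := fun a =>
    h (show (_, _) ∈ kerSet f from Function.surjInv_eq hf (f a))
  let k : C.Carrier →[L] M.Carrier := homOfMapFun (g ∘ Function.surjInv hf) (by
    intro n F x
    have hx : Structure.funMap F x = f (Structure.funMap F (Function.surjInv hf ∘ x)) := by
      rw [f.map_fun]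
      congr 1
      funext i
      exact (Function.surjInv_eq hf (x i)).symm
    rw [hx, Function.comp_apply, hg, g.map_fun]
    rfl)
  refine ⟨kerSet k, ⟨M, hM, k, rfl⟩, ?_⟩
  ext p
  change g _ = g _ ↔ g _ = g _
  rw [hg, hg]

theorem exists_restrict_eq_of_kerSet (hC : HasQCEP Q C) (f : B.Carrier →[L] C.Carrier)
    (S : L.Substructure B.Carrier) {θ : Set ((ofSub B S).Carrier × (ofSub B S).Carrier)}
    (hθ : θ ∈ ConQ Q (ofSub B S)) (h : restrict S (kerSet f) ⊆ θ) :
    ∃ Φ ∈ ConQ Q B, restrict S Φ = θ := by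
  let g : (ofSub B S).Carrier →[L] (ofSub C (S.map f)).Carrier :=
    homOfMapFun (fun a => ⟨f a, Substructure.mem_map_of_mem f a.2⟩) (by
      intro n F x
      apply Subtype.ext
      exact f.map_fun F fun i => (x i : B.Carrier))
  have hg : Function.Surjective g := by
    rintro ⟨_, a, ha, rfl⟩
    exact ⟨⟨a, ha⟩, rfl⟩
  obtain ⟨φ, hφ, rfl⟩ := exists_pullback_eq g hg hθ
    (fun p hp => h (congrArg Subtype.val (show g p.1 = g p.2 from hp)))
  obtain ⟨Φ, hΦ, rfl⟩ := hC (S.map f) φ hφ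
  exact ⟨pullback f Φ, pullback_mem_ConQ f hΦ, rfl⟩

theorem exists_restrict_eq_of_meetIrred (hQ : IsQuasivariety L Q) (hd : RelCongDist Q)
    (hR : ClassQCEP Q (RFSI Q)) (hB : B ∈ Q) (S : L.Substructure B.Carrier)
    {θ : Set ((ofSub B S).Carrier × (ofSub B S).Carrier)} (hθ : MeetIrred Q (ofSub B S) θ) :
    ∃ Φ ∈ ConQ Q B, restrict S Φ = θ := by
  have hdiag : restrict S (Set.diagonal B.Carrier) ⊆ θ := by
    obtain ⟨M, -, g, rfl⟩ := hθ.1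
    rintro p hp
    exact congrArg g (Subtype.ext hp)
  obtain ⟨Ψ, hΨ, hle, -, hmax⟩ := exists_maximal_ConQ hQ (fun Ψ => restrict S Ψ ⊆ θ)
    (by rintro c hc p ⟨s, hs, hp⟩; exact hc s hs hp) (diagonal_mem_ConQ hB) hdiag
  have hirr : MeetIrred Q B Ψ := by
    refine ⟨hΨ, fun Ψ₁ h₁ Ψ₂ h₂ he => ?_⟩
    refine (hθ.subset_or_subset hQ hd (hQ.2.1 B hB S) (restrict_mem_ConQ S h₁)
      (restrict_mem_ConQ S h₂) (fun p hp => hle (he ▸ hp))).imp (fun h => ?_) (fun h => ?_)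
    · exact (hmax Ψ₁ h₁ h (he.trans_subset inter_subset_left)).symm
    · exact (hmax Ψ₂ h₂ h (he.trans_subset inter_subset_right)).symm
  obtain ⟨M, hM, g, rfl⟩ := hΨ
  let k : B.Carrier →[L] (ofSub M g.range).Carrier :=
    homOfMapFun (fun b => ⟨g b, g.mem_range_self b⟩) (by
      intro n F x
      apply Subtype.ext
      exact g.map_fun F x)
  have hk : Function.Surjective k := by
    rintro ⟨_, b, rfl⟩
    exact ⟨b, rfl⟩
  have hker : kerSet k = kerSet g := by
    ext p
    exact Subtype.ext_iff
  rw [← hker] at hle hirr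
  exact exists_restrict_eq_of_kerSet
    (hR _ (mem_RFSI_of_surjective (hQ.2.1 M hM g.range) k hk hirr)) k S hθ.1 hle

end QuasivarietyCongruences

/-- Theorem 2.3: a relatively congruence-distributive quasivariety `Q` has the
`Q`-CEP iff `Q_RFSI` has the `Q`-CEP. -/
theorem stmt3 (L : FirstOrder.Language.{u, u}) [L.IsAlgebraic]
    (Q : Set (Struc L)) (hQ : IsQuasivariety L Q) (hd : RelCongDist Q) :
    ClassQCEP Q Q ↔ ClassQCEP Q (RFSI Q) := by
  refine ⟨fun h B hB => h B hB.1, fun hR B hB S θ hθ => ?_⟩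
  let T : Set (Set (B.Carrier × B.Carrier)) := {Φ | Φ ∈ ConQ Q B ∧ θ ⊆ restrict S Φ}
  refine ⟨⋂₀ T, sInter_mem_ConQ hQ fun Φ hΦ => hΦ.1, subset_antisymm (fun p hp => ?_)
    fun p hp Φ hΦ => hΦ.2 hp⟩
  by_contra hpθ
  obtain ⟨φ, hφ, hle, hpφ⟩ := exists_meetIrred_notMem hQ hθ hpθ
  obtain ⟨Φ, hΦ, rfl⟩ := exists_restrict_eq_of_meetIrred hQ hd hR hB S hφ
  exact hpφ (hp Φ ⟨hΦ, hle⟩)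

end Transfer
end

section
/- Let V be a congruence-distributive variety. Then V has the congruence extension property if and only if V_FSI has the congruence extension property (i.e., every member of V_FSI has the V-CEP). -/
open FirstOrder Language Set

universe u

namespace Transfer

variable (L : FirstOrder.Language.{u, u})

variable {L}

variable (L)

variable {L}

/-- A congruence of `A`: an equivalence relation compatible with the operations. -/
structure IsCong (A : Struc L) (θ : Set (A.Carrier × A.Carrier)) : Prop where
  refl : ∀ a, (a, a) ∈ θ
  symm : ∀ {a b}, (a, b) ∈ θ → (b, a) ∈ θ
  trans : ∀ {a b c}, (a, b) ∈ θ → (b, c) ∈ θ → (a, c) ∈ θ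
  funMap : ∀ {n} (F : L.Functions n) (x y : Fin n → A.Carrier), (∀ i, (x i, y i) ∈ θ) →
    (Structure.funMap F x, Structure.funMap F y) ∈ θ

namespace IsCong

variable {A C : Struc L}

theorem kerSet (f : A.Carrier →[L] C.Carrier) : IsCong A (kerSet f) where
  refl _ := rfl
  symm h := Eq.symm h
  trans h k := Eq.trans h k
  funMap F x y h := by
    change f _ = f _
    rw [f.map_fun, f.map_fun]
    exact congrArg _ (funext h)

theorem diagonal (A : Struc L) : IsCong A (Set.diagonal A.Carrier) where
  refl _ := rfl
  symm h := Eq.symm h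
  trans h k := Eq.trans h k
  funMap F _ _ h := congrArg (Structure.funMap F) (funext h)

theorem sInter {T : Set (Set (A.Carrier × A.Carrier))} (h : ∀ θ ∈ T, IsCong A θ) :
    IsCong A (⋂₀ T) where
  refl a θ hθ := (h θ hθ).refl a
  symm hab θ hθ := (h θ hθ).symm (hab θ hθ)
  trans hab hbc θ hθ := (h θ hθ).trans (hab θ hθ) (hbc θ hθ)
  funMap F x y hxy θ hθ := (h θ hθ).funMap F x y fun i => hxy i θ hθ

theorem inter {θ φ : Set (A.Carrier × A.Carrier)} (hθ : IsCong A θ) (hφ : IsCong A φ) :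
    IsCong A (θ ∩ φ) := by
  rw [← Set.sInter_pair]
  refine sInter ?_
  rintro _ (rfl | rfl)
  exacts [hθ, hφ]

theorem sUnion_of_isChain {T : Set (Set (A.Carrier × A.Carrier))} (h : ∀ θ ∈ T, IsCong A θ)
    (hT : IsChain (· ⊆ ·) T) (hne : T.Nonempty) : IsCong A (⋃₀ T) where
  refl a := hne.elim fun θ hθ => ⟨θ, hθ, (h θ hθ).refl a⟩
  symm := by
    rintro a b ⟨θ, hθ, hab⟩
    exact ⟨θ, hθ, (h θ hθ).symm hab⟩
  trans := by
    rintro a b c ⟨θ, hθ, hab⟩ ⟨φ, hφ, hbc⟩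
    rcases hT.total hθ hφ with hle | hle
    · exact ⟨φ, hφ, (h φ hφ).trans (hle hab) hbc⟩
    · exact ⟨θ, hθ, (h θ hθ).trans hab (hle hbc)⟩
  funMap F x y hxy := by
    choose t ht hxt using hxy
    have : Nonempty T := hne.to_subtype
    obtain ⟨z, hz⟩ := hT.directed.finite_le (r := (· ⊆ ·)) (f := fun θ : T => θ.1)
      fun i => ⟨t i, ht i⟩
    exact ⟨z, z.2, (h z z.2).funMap F x y fun i => hz i (hxt i)⟩

theorem preimage (f : A.Carrier →[L] C.Carrier) {θ : Set (C.Carrier × C.Carrier)}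
    (hθ : IsCong C θ) : IsCong A (Prod.map f f ⁻¹' θ) where
  refl a := hθ.refl (f a)
  symm h := hθ.symm h
  trans h k := hθ.trans h k
  funMap F x y h := by
    change (f _, f _) ∈ θ
    rw [f.map_fun, f.map_fun]
    exact hθ.funMap F _ _ h

theorem preimage_image (f : A.Carrier →[L] C.Carrier) {θ : Set (A.Carrier × A.Carrier)}
    (hθ : IsCong A θ) (hker : Transfer.kerSet f ⊆ θ) :
    Prod.map f f ⁻¹' (Prod.map f f '' θ) = θ := by
  refine Subset.antisymm ?_ (subset_preimage_image _ _)
  rintro ⟨a, b⟩ ⟨⟨c, d⟩, hcd, h⟩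
  obtain ⟨hca, hdb⟩ := Prod.mk.inj h
  exact hθ.trans (hker (show f a = f c from hca.symm)) (hθ.trans hcd (hker hdb))

theorem image (f : A.Carrier →[L] C.Carrier) (hf : Function.Surjective f)
    {θ : Set (A.Carrier × A.Carrier)} (hθ : IsCong A θ) (hker : Transfer.kerSet f ⊆ θ) :
    IsCong C (Prod.map f f '' θ) := by
  have key : ∀ a b, (f a, f b) ∈ Prod.map f f '' θ ↔ (a, b) ∈ θ := fun a b =>
    Set.ext_iff.1 (hθ.preimage_image f hker) (a, b)
  refine ⟨hf.forall.2 fun a => (key a a).2 (hθ.refl a), ?_, ?_, ?_⟩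
  · intro c d h
    obtain ⟨a, rfl⟩ := hf c
    obtain ⟨b, rfl⟩ := hf d
    exact (key _ _).2 (hθ.symm ((key _ _).1 h))
  · intro c d e h k
    obtain ⟨a, rfl⟩ := hf c
    obtain ⟨b, rfl⟩ := hf d
    obtain ⟨a', rfl⟩ := hf e
    exact (key _ _).2 (hθ.trans ((key _ _).1 h) ((key _ _).1 k))
  · intro n F x y h
    choose x' hx' using fun i => hf (x i)
    choose y' hy' using fun i => hf (y i)
    obtain rfl : f ∘ x' = x := funext hx'
    obtain rfl : f ∘ y' = y := funext hy'
    rw [← f.map_fun, ← f.map_fun]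
    exact (key _ _).2 (hθ.funMap F _ _ fun i => (key _ _).1 (h i))

/-- The setoid underlying a congruence. -/
def setoid {θ : Set (A.Carrier × A.Carrier)} (hθ : IsCong A θ) : Setoid A.Carrier where
  r a b := (a, b) ∈ θ
  iseqv := ⟨hθ.refl, hθ.symm, hθ.trans⟩

theorem exists_quotient [L.IsAlgebraic] {θ : Set (A.Carrier × A.Carrier)} (hθ : IsCong A θ) :
    ∃ (M : Struc L) (f : A.Carrier →[L] M.Carrier),
      Function.Surjective f ∧ θ = Transfer.kerSet f := by
  let s := hθ.setoid
  let p : L.Prestructure s :=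
    { toStructure := A.str
      fun_equiv := fun {_ F} x y h => hθ.funMap F x y h
      rel_equiv := fun {_ R} => isEmptyElim R }
  refine ⟨⟨Quotient s⟩, ⟨Quotient.mk s, fun F x => ?_, fun R => isEmptyElim R⟩,
    Quotient.mk_surjective, ?_⟩
  · exact (funMap_quotient_mk' s F x).symm
  · ext ⟨a, b⟩
    exact (Quotient.eq (r := s)).symm

end IsCong

section Variety

variable {V : Set (Struc L)} {A : Struc L}

theorem IsCong.of_mem_ConQ {θ : Set (A.Carrier × A.Carrier)} (h : θ ∈ ConQ V A) :
    IsCong A θ := by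
  obtain ⟨M, -, f, rfl⟩ := h
  exact IsCong.kerSet f

theorem IsVariety.exists_surjective_of_isCong [L.IsAlgebraic] (hV : IsVariety L V) (hA : A ∈ V)
    {θ : Set (A.Carrier × A.Carrier)} (hθ : IsCong A θ) :
    ∃ M ∈ V, ∃ f : A.Carrier →[L] M.Carrier, Function.Surjective f ∧ θ = kerSet f := by
  obtain ⟨M, f, hf, h⟩ := hθ.exists_quotient
  exact ⟨M, hV.1 A hA M f hf, f, hf, h⟩

theorem IsVariety.mem_ConQ_iff [L.IsAlgebraic] (hV : IsVariety L V) (hA : A ∈ V)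
    {θ : Set (A.Carrier × A.Carrier)} : θ ∈ ConQ V A ↔ IsCong A θ := by
  refine ⟨IsCong.of_mem_ConQ, fun h => ?_⟩
  obtain ⟨M, hM, f, -, rfl⟩ := hV.exists_surjective_of_isCong hA h
  exact ⟨M, hM, f, rfl⟩

theorem joinQ_subset {θ φ ψ : Set (A.Carrier × A.Carrier)} (hψ : ψ ∈ ConQ V A)
    (hθ : θ ⊆ ψ) (hφ : φ ⊆ ψ) : joinQ V A θ φ ⊆ ψ :=
  sInter_subset_of_mem ⟨hψ, union_subset hθ hφ⟩

theorem subset_joinQ (V : Set (Struc L)) (θ φ : Set (A.Carrier × A.Carrier)) :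
    θ ∪ φ ⊆ joinQ V A θ φ :=
  subset_sInter fun _ h => h.2

theorem IsVariety.joinQ_mem [L.IsAlgebraic] (hV : IsVariety L V) (hA : A ∈ V)
    (θ φ : Set (A.Carrier × A.Carrier)) : joinQ V A θ φ ∈ ConQ V A :=
  (hV.mem_ConQ_iff hA).2 (IsCong.sInter fun _ h => IsCong.of_mem_ConQ h.1)

/-- In a congruence-distributive variety, meet-irreducible congruences are meet-prime. -/
theorem MeetIrred.subset_or_subset_s4 [L.IsAlgebraic] (hV : IsVariety L V) (hd : RelCongDist V)
    (hA : A ∈ V) {θ α β : Set (A.Carrier × A.Carrier)} (hθ : MeetIrred V A θ)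
    (hα : α ∈ ConQ V A) (hβ : β ∈ ConQ V A) (h : α ∩ β ⊆ θ) : α ⊆ θ ∨ β ⊆ θ := by
  have hα' := subset_joinQ V θ α
  have hβ' := subset_joinQ V θ β
  have hle : joinQ V A θ α ∩ joinQ V A θ β ⊆ θ := by
    rw [hd A hA _ (hV.joinQ_mem hA θ α) θ hθ.1 β hβ]
    refine joinQ_subset hθ.1 inter_subset_right ?_
    rw [inter_comm, hd A hA β hβ θ hθ.1 α hα]
    exact joinQ_subset hθ.1 inter_subset_right (by rwa [inter_comm])
  have heq : θ = joinQ V A θ α ∩ joinQ V A θ β :=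
    Subset.antisymm (subset_inter (subset_union_left.trans hα') (subset_union_left.trans hβ')) hle
  rcases hθ.2 _ (hV.joinQ_mem hA θ α) _ (hV.joinQ_mem hA θ β) heq with h' | h'
  · exact .inl ((subset_union_right.trans hα').trans h'.symm.subset)
  · exact .inr ((subset_union_right.trans hβ').trans h'.symm.subset)

theorem IsVariety.exists_maximal_disjoint [L.IsAlgebraic] (hV : IsVariety L V) (hA : A ∈ V)
    {θ N : Set (A.Carrier × A.Carrier)} (hθ : θ ∈ ConQ V A) (hN : Disjoint θ N) :
    ∃ m, θ ⊆ m ∧ Maximal (fun φ => φ ∈ ConQ V A ∧ Disjoint φ N) m :=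
  zorn_subset_nonempty {φ | φ ∈ ConQ V A ∧ Disjoint φ N}
    (fun T hT hc hne => ⟨⋃₀ T,
      ⟨(hV.mem_ConQ_iff hA).2 (IsCong.sUnion_of_isChain
        (fun _ hφ => IsCong.of_mem_ConQ (hT hφ).1) hc hne),
        disjoint_sUnion_left.2 fun _ hφ => (hT hφ).2⟩,
      fun _ hφ => subset_sUnion_of_mem hφ⟩) θ ⟨hθ, hN⟩

/-- Every congruence omitting a pair lies below a meet-irreducible one omitting that pair. -/
theorem IsVariety.exists_meetIrred [L.IsAlgebraic] (hV : IsVariety L V) (hA : A ∈ V)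
    {θ : Set (A.Carrier × A.Carrier)} (hθ : θ ∈ ConQ V A) {p : A.Carrier × A.Carrier}
    (hp : p ∉ θ) : ∃ m, θ ⊆ m ∧ p ∉ m ∧ MeetIrred V A m := by
  obtain ⟨m, hm, hmax⟩ := hV.exists_maximal_disjoint hA hθ (disjoint_singleton_right.2 hp)
  have hpm : p ∉ m := disjoint_singleton_right.1 hmax.prop.2
  refine ⟨m, hm, hpm, hmax.prop.1, fun θ₁ h₁ θ₂ h₂ h => ?_⟩
  by_cases hp₁ : p ∈ θ₁
  · have hp₂ : p ∉ θ₂ := fun hp₂ => hpm (h ▸ ⟨hp₁, hp₂⟩)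
    exact .inr (hmax.eq_of_subset ⟨h₂, disjoint_singleton_right.2 hp₂⟩
      (h.subset.trans inter_subset_right))
  · exact .inl (hmax.eq_of_subset ⟨h₁, disjoint_singleton_right.2 hp₁⟩
      (h.subset.trans inter_subset_left))

/-- A meet-irreducible congruence of a substructure of `B` contains the restriction of some
meet-irreducible congruence of `B`. -/
theorem MeetIrred.exists_restrict_subset [L.IsAlgebraic] (hV : IsVariety L V)
    (hd : RelCongDist V) {B : Struc L} (hB : B ∈ V) (S : L.Substructure B.Carrier)
    {θ : Set ((ofSub B S).Carrier × (ofSub B S).Carrier)} (hθ : MeetIrred V (ofSub B S) θ) :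
    ∃ Φ, MeetIrred V B Φ ∧ restrict S Φ ⊆ θ := by
  have hS := hV.2.1 B hB S
  have hdisj : ∀ Φ : Set (B.Carrier × B.Carrier),
      Disjoint Φ (lift S θᶜ) ↔ restrict S Φ ⊆ θ := fun Φ => by
    rw [lift, disjoint_image_right, disjoint_compl_right_iff_subset]
    rfl
  have hres : ∀ Φ ∈ ConQ V B, restrict S Φ ∈ ConQ V (ofSub B S) := fun Φ hΦ =>
    (hV.mem_ConQ_iff hS).2
      (IsCong.preimage (A := ofSub B S) S.subtype.toHom (IsCong.of_mem_ConQ hΦ))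
  have hΔ : restrict S (Set.diagonal B.Carrier) ⊆ θ := by
    rintro ⟨a, b⟩ hab
    obtain rfl : a = b := Subtype.ext hab
    exact (IsCong.of_mem_ConQ hθ.1).refl a
  obtain ⟨Φ, -, hmax⟩ := hV.exists_maximal_disjoint hB
    ((hV.mem_ConQ_iff hB).2 (IsCong.diagonal B)) ((hdisj _).2 hΔ)
  have hΦ := (hdisj _).1 hmax.prop.2
  refine ⟨Φ, ⟨hmax.prop.1, fun Φ₁ h₁ Φ₂ h₂ h => ?_⟩, hΦ⟩
  have hle : restrict S Φ₁ ∩ restrict S Φ₂ ⊆ θ := by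
    rw [h] at hΦ
    exact hΦ
  refine (hθ.subset_or_subset_s4 hV hd hS (hres _ h₁) (hres _ h₂) hle).imp (fun h' => ?_) fun h' => ?_
  · exact hmax.eq_of_subset ⟨h₁, (hdisj _).2 h'⟩ (h.subset.trans inter_subset_left)
  · exact hmax.eq_of_subset ⟨h₂, (hdisj _).2 h'⟩ (h.subset.trans inter_subset_right)

/-- The quotient by a meet-irreducible congruence is finitely subdirectly irreducible. -/
theorem MeetIrred.mem_RFSI [L.IsAlgebraic] (hV : IsVariety L V) (hA : A ∈ V) {M : Struc L}
    (hM : M ∈ V) (f : A.Carrier →[L] M.Carrier) (hf : Function.Surjective f)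
    (h : MeetIrred V A (kerSet f)) : M ∈ RFSI V := by
  have hpre : ∀ θ ∈ ConQ V M, Prod.map f f ⁻¹' θ ∈ ConQ V A := fun θ hθ =>
    (hV.mem_ConQ_iff hA).2 ((IsCong.of_mem_ConQ hθ).preimage f)
  have hinj := (hf.prodMap hf).preimage_injective
  refine ⟨hM, (hV.mem_ConQ_iff hM).2 (IsCong.diagonal M), fun θ₁ h₁ θ₂ h₂ he => ?_⟩
  refine (h.2 _ (hpre _ h₁) _ (hpre _ h₂) (congrArg (Prod.map f f ⁻¹' ·) he)).imp
    (fun heq => hinj heq) fun heq => hinj heq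

/-- If `B` maps onto an algebra with the congruence extension property, then congruences of a
substructure of `B` containing the restricted kernel extend to `B`. -/
theorem HasQCEP.exists_extension [L.IsAlgebraic] (hV : IsVariety L V) {B M : Struc L}
    (hB : B ∈ V) (hM : M ∈ V) (hcep : HasQCEP V M) (f : B.Carrier →[L] M.Carrier)
    (S : L.Substructure B.Carrier) {θ : Set ((ofSub B S).Carrier × (ofSub B S).Carrier)}
    (hθ : IsCong (ofSub B S) θ) (hker : restrict S (kerSet f) ⊆ θ) :
    ∃ Φ ∈ ConQ V B, restrict S Φ = θ := by
  let T := S.map f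
  let g : (ofSub B S).Carrier →[L] (ofSub M T).Carrier :=
    (f.comp S.subtype.toHom).codRestrict T fun a => ⟨a, a.2, rfl⟩
  have hg : Function.Surjective g := by
    rintro ⟨_, a, ha, rfl⟩
    exact ⟨⟨a, ha⟩, rfl⟩
  have hkg : kerSet g ⊆ θ := fun p hp => hker (congrArg Subtype.val hp)
  obtain ⟨Ψ, hΨ, hr⟩ := hcep T _
    ((hV.mem_ConQ_iff (hV.2.1 M hM T)).2 (hθ.image g hg hkg))
  refine ⟨Prod.map f f ⁻¹' Ψ, (hV.mem_ConQ_iff hB).2 ((IsCong.of_mem_ConQ hΨ).preimage f), ?_⟩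
  rw [← hθ.preimage_image g hkg, ← hr]
  rfl

end Variety

/-- Corollary 2.4: a congruence-distributive variety `V` has the CEP iff
`V_FSI` has the CEP. -/
theorem stmt4 (L : FirstOrder.Language.{u, u}) [L.IsAlgebraic]
    (V : Set (Struc L)) (hV : IsVariety L V) (hd : RelCongDist V) :
    ClassQCEP V V ↔ ClassQCEP V (RFSI V) := by
  refine ⟨fun h B hB => h B hB.1, fun h B hB S θ hθ => ?_⟩
  have hS := hV.2.1 B hB S
  have hext : ∀ p ∉ θ, ∃ Φ ∈ ConQ V B, θ ⊆ restrict S Φ ∧ p ∉ restrict S Φ := by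
    intro p hp
    obtain ⟨m, hm, hpm, hirr⟩ := hV.exists_meetIrred hS hθ hp
    obtain ⟨Φ, hΦ, hΦm⟩ := hirr.exists_restrict_subset hV hd hB S
    obtain ⟨M, hM, f, hf, rfl⟩ :=
      hV.exists_surjective_of_isCong hB (IsCong.of_mem_ConQ hΦ.1)
    obtain ⟨Ψ, hΨ, rfl⟩ := (h M (hΦ.mem_RFSI hV hB hM f hf)).exists_extension hV hB hM f S
      (IsCong.of_mem_ConQ hirr.1) hΦm
    exact ⟨Ψ, hΨ, hm, hpm⟩
  refine ⟨⋂₀ {Φ | Φ ∈ ConQ V B ∧ θ ⊆ restrict S Φ},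
    (hV.mem_ConQ_iff hB).2 (IsCong.sInter fun _ hΦ => IsCong.of_mem_ConQ hΦ.1),
    Subset.antisymm (fun p hp => ?_) fun p hp Φ hΦ => hΦ.2 hp⟩
  by_contra hpθ
  obtain ⟨Φ, hΦ, hle, hpΦ⟩ := hext p hpθ
  exact hpΦ (hp Φ ⟨hΦ, hle⟩)

end Transfer
end

section
/- Let Q be a quasivariety and K ⊆ Q a class satisfying: (i) K is closed under isomorphisms; (ii) for every B ∈ Q and every substructure A of B with A ∈ K, there exist C ∈ K and a surjective homomorphism g : B → C with ker g ∩ (A×A) = Δ_A; (iii) K has the Q-congruence extension property. Then K has the extension property. -/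
open FirstOrder Language Set

universe u

namespace Transfer

variable (L : FirstOrder.Language.{u, u})

variable {L}

variable (L)

variable {L}

/-- In a language without relations, an injective homomorphism is an embedding. -/
def embeddingOfInjective {L : FirstOrder.Language.{u, u}} [L.IsAlgebraic] {M N : Type u}
    [L.Structure M] [L.Structure N] (f : M →[L] N) (hf : Function.Injective f) : M ↪[L] N where
  toFun := f
  inj' := hf
  map_fun' := f.map_fun'
  map_rel' r := isEmptyElim r

/-- In a language without relations, a homomorphism whose kernel contains the kernel of a
surjective homomorphism factors through it. -/
theorem exists_hom_factor {L : FirstOrder.Language.{u, u}} [L.IsAlgebraic] {M N P : Type u}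
    [L.Structure M] [L.Structure N] [L.Structure P] (p : M →[L] N) (hp : Function.Surjective p)
    (f : M →[L] P) (hpf : ∀ a a', p a = p a' → f a = f a') :
    ∃ k : N →[L] P, ∀ a, k (p a) = f a := by
  choose s hs using hp
  refine ⟨{ toFun := fun c => f (s c), map_fun' := ?_, map_rel' := fun r => isEmptyElim r },
    fun a => hpf _ _ (hs _)⟩
  intro n F x
  change f (s (Structure.funMap F x)) = Structure.funMap F (f ∘ s ∘ x)
  rw [← f.map_fun]
  refine hpf _ _ ?_
  rw [hs, p.map_fun]
  congr 1
  exact funext fun i => (hs (x i)).symm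

/-- Proposition 2.8: a subclass `K` of a quasivariety `Q` that is closed under
isomorphisms, satisfies the separation condition (ii), and has the `Q`-CEP, has the EP. -/
theorem stmt7 (L : FirstOrder.Language.{u, u}) [L.IsAlgebraic]
    (Q K : Set (Struc L)) (hQ : IsQuasivariety L Q) (hKQ : K ⊆ Q)
    (h1 : IsoClosed K)
    (h2 : ∀ B ∈ Q, ∀ S : L.Substructure B.Carrier, ofSub B S ∈ K →
      ∃ C ∈ K, ∃ g : B.Carrier →[L] C.Carrier, Function.Surjective g ∧
        restrict S (kerSet ⇑g) = Set.diagonal (ofSub B S).Carrier)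
    (h3 : ClassQCEP Q K) :
    HasEP K := by
  intro A _ B hB C hC φB φC hφB hφC
  set eB := embeddingOfInjective φB hφB
  -- extend the kernel of `φC` from the image of `A` to `B`
  obtain ⟨Φ, ⟨M, hM, h, rfl⟩, hΦ⟩ := h3 B hB eB.toHom.range
    (kerSet ⇑(φC.comp eB.equivRange.symm.toHom)) ⟨C, hKQ hC, _, rfl⟩
  have hker : ∀ a a' : A.Carrier, h (φB a) = h (φB a') ↔ φC a = φC a' := by
    intro a a'
    have key : (eB.equivRange a, eB.equivRange a') ∈ restrict eB.toHom.range (kerSet ⇑h) ↔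
        (eB.equivRange a, eB.equivRange a') ∈
          kerSet ⇑(φC.comp eB.equivRange.symm.toHom) := by
      rw [hΦ]
    have hC_iff : (eB.equivRange a, eB.equivRange a') ∈
        kerSet ⇑(φC.comp eB.equivRange.symm.toHom) ↔ φC a = φC a' := by
      change φC (eB.equivRange.symm (eB.equivRange a)) =
        φC (eB.equivRange.symm (eB.equivRange a')) ↔ _
      rw [eB.equivRange.symm_apply_apply, eB.equivRange.symm_apply_apply]
    exact key.trans hC_iff
  obtain ⟨k, hk⟩ := exists_hom_factor φC hφC (h.comp φB) fun a a' => (hker a a').2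
  have hk_inj : Function.Injective k := by
    intro c c' hcc
    obtain ⟨a, rfl⟩ := hφC c
    obtain ⟨a', rfl⟩ := hφC c'
    rw [hk, hk] at hcc
    exact (hker a a').1 hcc
  set eC := embeddingOfInjective k hk_inj
  obtain ⟨D, hD, g, -, hg⟩ := h2 M hM eC.toHom.range (h1 C hC _ ⟨eC.equivRange⟩)
  refine ⟨D, hD, g.comp h, g.comp k, ?_, fun a => congrArg g (hk a).symm⟩
  intro c c' hcc
  have hmem : (eC.equivRange c, eC.equivRange c') ∈ restrict eC.toHom.range (kerSet ⇑g) := hcc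
  rw [hg] at hmem
  exact eC.equivRange.injective hmem

end Transfer
end

section
/- Let Q be a quasivariety and K ⊆ Q a class satisfying: (i) K is closed under substructures; (ii) every relatively subdirectly irreducible member of Q belongs to K; (iii) K has the extension property. Then K has the Q-congruence extension property. -/
open FirstOrder Language Set

universe u

namespace Transfer

variable (L : FirstOrder.Language.{u, u})

variable {L}

variable (L)

variable {L}

/-- The union of a nonempty chain of `Q`-congruences is a `Q`-congruence. -/
theorem sUnion_mem_conQ [L.IsAlgebraic] {Q : Set (Struc L)} (hQ : IsQuasivariety L Q)
    (A : Struc L) {c : Set (Set (A.Carrier × A.Carrier))} (hc : c ⊆ ConQ Q A)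
    (hchain : IsChain (· ⊆ ·) c) (hne : c.Nonempty) : ⋃₀ c ∈ ConQ Q A := by
  choose M hM f hf using fun θ : c => hc θ.2
  have : Nonempty c := hne.to_subtype
  have : IsDirectedOrder c := ⟨hchain.directedOn.directed_val⟩
  let U : Ultrafilter c := Ultrafilter.of Filter.atTop
  refine ⟨_, hQ.2.2.2 c M U hM, ⟨fun a => Quotient.mk'' fun θ => f θ a, ?_, ?_⟩, ?_⟩
  · intro n g x
    refine Eq.trans ?_ (Ultraproduct.funMap_cast g fun i θ => f θ (x i)).symm
    exact congrArg Quotient.mk'' (funext fun θ => (f θ).map_fun g x)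
  · intro n r
    exact isEmptyElim r
  · ext ⟨a, b⟩
    have hmem (θ : c) : (a, b) ∈ θ.1 ↔ f θ a = f θ b := by
      rw [hf θ]
      rfl
    have hker : (Quotient.mk'' (fun θ => f θ a) :
          (U : Filter c).Product fun θ => (M θ).Carrier) = Quotient.mk'' (fun θ => f θ b) ↔
        ∀ᶠ θ in (U : Filter c), f θ a = f θ b := Quotient.eq''
    refine Iff.trans ⟨?_, ?_⟩ hker.symm
    · rintro ⟨θ, hθ, hab⟩
      have hle : ∀ᶠ φ in (U : Filter c), (⟨θ, hθ⟩ : c) ≤ φ :=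
        Ultrafilter.of_le _ (Filter.eventually_ge_atTop _)
      filter_upwards [hle] with φ hφ
      exact (hmem φ).1 (hφ hab)
    · intro h
      obtain ⟨θ, hθ⟩ := h.exists
      exact ⟨θ.1, θ.2, (hmem θ).2 hθ⟩

/-- The intersection of the kernels of a family of homomorphisms into members of `Q` is a
`Q`-congruence. -/
theorem iInter_kerSet_mem_conQ [L.IsAlgebraic] {Q : Set (Struc L)} (hQ : IsQuasivariety L Q)
    (A : Struc L) {ι : Type u} (M : ι → Struc L) (hM : ∀ i, M i ∈ Q)
    (f : ∀ i, A.Carrier →[L] (M i).Carrier) : ⋂ i, kerSet (f i) ∈ ConQ Q A := by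
  refine ⟨_, hQ.2.2.1 ι M hM, ⟨fun a i => f i a, ?_, ?_⟩, ?_⟩
  · intro n g x
    exact funext fun i => (f i).map_fun g x
  · intro n r
    exact isEmptyElim r
  · ext ⟨a, b⟩
    exact mem_iInter.trans funext_iff.symm

/-- A `Q`-congruence omitting a pair extends to one, still omitting that pair, whose quotient is
relatively subdirectly irreducible. -/
theorem exists_surjective_RSI [L.IsAlgebraic] {Q : Set (Struc L)} (hQ : IsQuasivariety L Q)
    (A : Struc L) {θ : Set (A.Carrier × A.Carrier)} (hθ : θ ∈ ConQ Q A)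
    {p : A.Carrier × A.Carrier} (hp : p ∉ θ) :
    ∃ C ∈ RSI Q, ∃ f : A.Carrier →[L] C.Carrier,
      Function.Surjective f ∧ θ ⊆ kerSet f ∧ p ∉ kerSet f := by
  obtain ⟨μ, hθμ, hμ⟩ := zorn_subset_nonempty {φ | φ ∈ ConQ Q A ∧ p ∉ φ}
    (fun c hc hchain hne => ⟨⋃₀ c,
      ⟨sUnion_mem_conQ hQ A (fun φ hφ => (hc hφ).1) hchain hne,
        fun ⟨φ, hφ, h⟩ => (hc hφ).2 h⟩,
      fun φ hφ => subset_sUnion_of_mem hφ⟩) θ ⟨hθ, hp⟩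
  obtain ⟨⟨M, hM, f, rfl⟩, hpf⟩ := hμ.prop
  let g : A.Carrier →[L] (ofSub M f.range).Carrier :=
    f.codRestrict f.range fun a => f.mem_range_self a
  have hg : kerSet g = kerSet f := by
    ext q
    exact Subtype.ext_iff
  have hgsurj : Function.Surjective g := by
    rintro ⟨_, y, rfl⟩
    exact ⟨y, rfl⟩
  have hrange : ofSub M f.range ∈ Q := hQ.2.1 M hM f.range
  refine ⟨ofSub M f.range, ⟨hrange, ⟨_, hrange, Hom.id L _, rfl⟩, fun S hS hSΔ => ?_⟩,
    g, hgsurj, hg ▸ hθμ, hg ▸ hpf⟩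
  have hpΔ : (g p.1, g p.2) ∉ ⋂₀ S := by
    rw [← hSΔ]
    intro h
    exact hpf (hg ▸ h)
  obtain ⟨φ, hφS, hpφ⟩ : ∃ φ ∈ S, (g p.1, g p.2) ∉ φ := by
    simpa only [mem_sInter, not_forall, exists_prop] using hpΔ
  obtain ⟨N, hN, h, rfl⟩ := hS hφS
  have hle : kerSet f ⊆ kerSet (h.comp g) := by
    rw [← hg]
    exact fun q hq => congrArg h hq
  have hge : kerSet (h.comp g) ⊆ kerSet f := hμ.le_of_ge ⟨⟨N, hN, _, rfl⟩, hpφ⟩ hle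
  have hΔ : Set.diagonal (ofSub M f.range).Carrier = kerSet h := by
    refine Subset.antisymm (fun q hq => congrArg h hq) ?_
    rintro ⟨x, y⟩ hxy
    obtain ⟨a, rfl⟩ := hgsurj x
    obtain ⟨b, rfl⟩ := hgsurj y
    have hab : (a, b) ∈ kerSet g := hg ▸ hge hxy
    exact hab
  exact hΔ ▸ hφS

/-- Proposition 2.10: a subclass `K` of a quasivariety `Q` closed under
substructures, containing all relatively subdirectly irreducible members of `Q`, and with the
EP, has the `Q`-CEP. -/
theorem stmt9 (L : FirstOrder.Language.{u, u}) [L.IsAlgebraic]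
    (Q K : Set (Struc L)) (hQ : IsQuasivariety L Q) (hKQ : K ⊆ Q)
    (h1 : SubClosed K) (h2 : RSI Q ⊆ K) (h3 : HasEP K) :
    ClassQCEP Q K := by
  intro B hB S θ hθ
  have key (p : (θᶜ : Set ((ofSub B S).Carrier × (ofSub B S).Carrier))) :
      ∃ D ∈ K, ∃ ψ : B.Carrier →[L] D.Carrier,
        θ ⊆ restrict S (kerSet ψ) ∧ p.1 ∉ restrict S (kerSet ψ) := by
    obtain ⟨C, hC, f, hf, hθf, hpf⟩ := exists_surjective_RSI hQ (ofSub B S) hθ p.2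
    obtain ⟨D, hD, ψB, ψC, hψC, hcomm⟩ := h3 (ofSub B S) (h1 B hB S) B hB C (h2 hC)
      S.subtype.toHom f S.subtype.injective hf
    have hker : restrict S (kerSet ψB) = kerSet f := by
      ext q
      have hq : ψB q.1.1 = ψB q.2.1 ↔ f q.1 = f q.2 := by
        rw [← hψC.eq_iff, ← hcomm, ← hcomm]
        rfl
      exact hq
    exact ⟨D, hD, ψB, hker ▸ hθf, hker ▸ hpf⟩
  choose D hD ψ hθψ hpψ using key
  refine ⟨_, iInter_kerSet_mem_conQ hQ B D (fun p => hKQ (hD p)) ψ, Subset.antisymm ?_ ?_⟩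
  · intro q hq
    by_contra hqθ
    exact hpψ ⟨q, hqθ⟩ (mem_iInter.1 hq ⟨q, hqθ⟩)
  · intro q hq
    exact mem_iInter.2 fun p => hθψ p hq

end Transfer
end
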